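/- arXiv:math/0701513 — 2 statements merged into one kernel-verified Lean document; each statement's English description precedes it below -/
import Mathlib

section
/- Let n ≥ 1, σ > 0, g ∈ ℝⁿ, and let M be a Borel probability measure on ℝⁿ. Let p_h denote the Lebesgue density of the Gaussian measure N(h, σ²Iₙ) and define the mixture density q(y) = ∫ p_f(y) dM(f). If the double integral ∫∫ exp((1/σ²)∑ᵢ(fᵢ−gᵢ)(νᵢ−gᵢ)) dM(f) dM(ν) is finite, then ∫_{ℝⁿ} |p_g(y) − q(y)| dy ≤ √( ∫∫ exp((1/σ²)∑ᵢ(fᵢ−gᵢ)(νᵢ−gᵢ)) dM(f) dM(ν) − 1 ). In particular, if M is the uniform distribution on a finite nonempty set Ω ⊆ ℝⁿ, then ∫|p_g − q| ≤ √( |Ω|⁻² ∑_{f,ν∈Ω} exp((1/σ²)∑ᵢ(fᵢ−gᵢ)(νᵢ−gᵢ)) − 1 ). -/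
open MeasureTheory ProbabilityTheory Real

noncomputable section

/-- Product Gaussian measure `N(f, σ² Iₙ)` on `ℝⁿ`. -/
def gaussP (n : ℕ) (f : Fin n → ℝ) (σ : ℝ) : Measure (Fin n → ℝ) :=
  Measure.pi fun i => gaussianReal (f i) (Real.toNNReal (σ ^ 2))

/-- Standard normal CDF `Φ`. -/
def stdCDF (x : ℝ) : ℝ := ((gaussianReal 0 1) (Set.Iic x)).toReal

/-- Standard normal density `φ`. -/
def stdPDF (x : ℝ) : ℝ := Real.exp (-(x ^ 2) / 2) / Real.sqrt (2 * Real.pi)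

/-- `τ(ε) = Φ(ε/2) - Φ(-ε/2)`. -/
def tau (ε : ℝ) : ℝ := stdCDF (ε / 2) - stdCDF (-(ε / 2))

/-- Inverse of `τ`. -/
def tauInv (p : ℝ) : ℝ := Function.invFun tau p

/-- Standard normal quantile function `Φ⁻¹`. -/
def PhiInv (p : ℝ) : ℝ := Function.invFun stdCDF p

/-- Normalized Euclidean norm `‖v‖ = √((1/n) ∑ vᵢ²)`. -/
def norm2 (n : ℕ) (v : Fin n → ℝ) : ℝ := Real.sqrt ((∑ i, (v i) ^ 2) / n)

/-- Sup norm `‖v‖_∞ = maxᵢ |vᵢ|`. -/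
def normInf (n : ℕ) (v : Fin n → ℝ) : ℝ := ⨆ i, |v i|

/-- Normalized inner product. -/
def inner2 (n : ℕ) (u v : Fin n → ℝ) : ℝ := (∑ i, u i * v i) / n

/-- Total variation distance between two measures on `ℝⁿ`. -/
def dTV (n : ℕ) (P Q : Measure (Fin n → ℝ)) : ℝ :=
  ⨆ A : {A : Set (Fin n → ℝ) // MeasurableSet A}, |(P A).toReal - (Q A).toReal|

/-- Width of the band `(L, U)` at data `y`. -/
def width (n : ℕ) (L U : (Fin n → ℝ) → Fin n → ℝ) (y : Fin n → ℝ) : ℝ :=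
  ⨆ i, (U y i - L y i)

/-- The band `(L,U)` covers `g` at data `y`. -/
def covers (n : ℕ) (L U : (Fin n → ℝ) → Fin n → ℝ) (g y : Fin n → ℝ) : Prop :=
  ∀ i, L y i ≤ g i ∧ g i ≤ U y i

/-- `P` is the orthogonal projection onto the subspace `F` of `ℝⁿ`. -/
def IsOrthProjOn (n : ℕ) (F : Submodule ℝ (Fin n → ℝ))
    (P : (Fin n → ℝ) →ₗ[ℝ] (Fin n → ℝ)) : Prop :=
  (∀ f, P f ∈ F) ∧ (∀ f, ∀ g ∈ F, inner2 n (f - P f) g = 0)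

/-- `Ω_F = max_i ‖Π_F eᵢ‖ / ‖eᵢ‖`. -/
def OmegaF (n : ℕ) (P : (Fin n → ℝ) →ₗ[ℝ] (Fin n → ℝ)) : ℝ :=
  ⨆ i : Fin n, norm2 n (P (Pi.single i 1)) / norm2 n (Pi.single i 1)

/-- The `p`-quantile of the chi-squared distribution with `m` degrees of freedom. -/
def chiSqQuantile (m : ℕ) (p : ℝ) : ℝ :=
  sInf {t : ℝ | ENNReal.ofReal p ≤
    (Measure.pi fun _ : Fin m => gaussianReal 0 1) {z | ∑ k, (z k) ^ 2 ≤ t}}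


/-- Lebesgue density of the product Gaussian `N(h, σ²Iₙ)` on `ℝⁿ`. -/
def gaussPDF (n : ℕ) (h : Fin n → ℝ) (σ : ℝ) (y : Fin n → ℝ) : ℝ :=
  ∏ i, gaussianPDFReal (h i) (Real.toNNReal (σ ^ 2)) (y i)
theorem gaussPDF_eq_exp (n : ℕ) (h : Fin n → ℝ) (σ : ℝ) (y : Fin n → ℝ) :
    gaussPDF n h σ y =
      (√(2 * π * σ ^ 2))⁻¹ ^ n * Real.exp (∑ i, -(y i - h i) ^ 2 / (2 * σ ^ 2)) := by
  simp [gaussPDF, gaussianPDFReal, Finset.prod_mul_distrib, Real.exp_sum,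
    max_eq_left (sq_nonneg σ)]

theorem gaussPDF_pos (n : ℕ) (h : Fin n → ℝ) {σ : ℝ} (hσ : 0 < σ) (y : Fin n → ℝ) :
    0 < gaussPDF n h σ y := by
  rw [gaussPDF_eq_exp]
  positivity

theorem integrable_gaussPDF (n : ℕ) (h : Fin n → ℝ) (σ : ℝ) :
    Integrable (gaussPDF n h σ) :=
  Integrable.fintype_prod fun i => integrable_gaussianPDFReal (h i) _

theorem integral_gaussPDF (n : ℕ) (h : Fin n → ℝ) {σ : ℝ} (hσ : 0 < σ) :
    ∫ y, gaussPDF n h σ y = 1 := by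
  have hv : Real.toNNReal (σ ^ 2) ≠ 0 := (Real.toNNReal_pos.2 (pow_pos hσ 2)).ne'
  simp only [gaussPDF]
  rw [integral_fintype_prod_volume_eq_prod]
  simp [integral_gaussianPDFReal_eq_one _ hv]

theorem continuous_gaussPDF (n : ℕ) (σ : ℝ) :
    Continuous fun z : (Fin n → ℝ) × (Fin n → ℝ) => gaussPDF n z.2 σ z.1 := by
  simp only [gaussPDF_eq_exp]
  fun_prop

/-- The product of two Gaussian densities divided by a third is a rescaled Gaussian density. -/
theorem gaussPDF_mul_div (n : ℕ) (f ν g : Fin n → ℝ) {σ : ℝ} (hσ : 0 < σ) (y : Fin n → ℝ) :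
    gaussPDF n f σ y * gaussPDF n ν σ y / gaussPDF n g σ y =
      Real.exp ((∑ i, (f i - g i) * (ν i - g i)) / σ ^ 2) * gaussPDF n (f + ν - g) σ y := by
  rw [div_eq_iff (gaussPDF_pos n g hσ y).ne']
  simp only [gaussPDF_eq_exp]
  have hexp : Real.exp (∑ i, -(y i - f i) ^ 2 / (2 * σ ^ 2)) *
        Real.exp (∑ i, -(y i - ν i) ^ 2 / (2 * σ ^ 2)) =
      Real.exp ((∑ i, (f i - g i) * (ν i - g i)) / σ ^ 2) *
        Real.exp (∑ i, -(y i - (f + ν - g) i) ^ 2 / (2 * σ ^ 2)) *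
        Real.exp (∑ i, -(y i - g i) ^ 2 / (2 * σ ^ 2)) := by
    rw [← Real.exp_add, ← Real.exp_add, ← Real.exp_add, Finset.sum_div,
      ← Finset.sum_add_distrib, ← Finset.sum_add_distrib, ← Finset.sum_add_distrib]
    congr 1
    refine Finset.sum_congr rfl fun i _ => ?_
    simp only [Pi.add_apply, Pi.sub_apply]
    field_simp
    ring
  linear_combination (√(2 * π * σ ^ 2))⁻¹ ^ n * (√(2 * π * σ ^ 2))⁻¹ ^ n * hexp

/-- The `L¹` distance between two functions of integral one is bounded by the square root of
their `χ²` divergence. -/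
theorem integral_abs_sub_le_sqrt_chiSq {α : Type*} [MeasurableSpace α] {μ : Measure α}
    {p q : α → ℝ} (hp_pos : ∀ x, 0 < p x) (hp : Integrable p μ) (hq : Integrable q μ)
    (hqp : Integrable (fun x => q x ^ 2 / p x) μ)
    (hp_one : ∫ x, p x ∂μ = 1) (hq_one : ∫ x, q x ∂μ = 1) :
    ∫ x, |p x - q x| ∂μ ≤ √((∫ x, q x ^ 2 / p x ∂μ) - 1) := by
  refine Real.le_sqrt_of_sq_le ?_
  set A := ∫ x, |p x - q x| ∂μ with hA
  have habs : Integrable (fun x => |p x - q x|) μ := (hp.sub hq).abs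
  have hnonneg : 0 ≤ ∫ x, ((q x ^ 2 / p x - 2 * q x + p x) - 2 * A * |p x - q x|
      + A ^ 2 * p x) ∂μ := by
    refine integral_nonneg fun x => ?_
    have hx := hp_pos x
    have : (q x ^ 2 / p x - 2 * q x + p x) - 2 * A * |p x - q x| + A ^ 2 * p x =
        (|p x - q x| - A * p x) ^ 2 / p x := by
      have h2 := sq_abs (p x - q x)
      field_simp
      linear_combination -h2
    change 0 ≤ _
    rw [this]
    positivity
  have h2q : Integrable (fun x => 2 * q x) μ := hq.const_mul 2
  have hsub : Integrable (fun x => q x ^ 2 / p x - 2 * q x) μ := hqp.sub h2q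
  have hchi : Integrable (fun x => q x ^ 2 / p x - 2 * q x + p x) μ := hsub.add hp
  have hcross : Integrable (fun x => 2 * A * |p x - q x|) μ := habs.const_mul _
  have hdiff : Integrable (fun x => q x ^ 2 / p x - 2 * q x + p x - 2 * A * |p x - q x|) μ :=
    hchi.sub hcross
  rw [integral_add hdiff (hp.const_mul _), integral_sub hchi hcross, integral_add hsub hp,
    integral_sub hqp h2q, integral_const_mul, integral_const_mul, integral_const_mul, hp_one,
    hq_one, ← hA] at hnonneg
  linarith

section Mixture

variable {n : ℕ} {σ : ℝ} {g : Fin n → ℝ} {M : Measure (Fin n → ℝ)} [IsProbabilityMeasure M]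

theorem integrable_gaussPDF_prod (hσ : 0 < σ) :
    Integrable (fun z : (Fin n → ℝ) × (Fin n → ℝ) => gaussPDF n z.2 σ z.1)
      ((volume : Measure (Fin n → ℝ)).prod M) := by
  rw [integrable_prod_iff' (continuous_gaussPDF n σ).aestronglyMeasurable]
  refine ⟨ae_of_all _ fun f => integrable_gaussPDF n f σ, ?_⟩
  simp [Real.norm_of_nonneg (gaussPDF_pos n _ hσ _).le, integral_gaussPDF n _ hσ]

theorem integral_gaussPDF_mixture (hσ : 0 < σ) :
    ∫ y, ∫ f, gaussPDF n f σ y ∂M = 1 := by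
  rw [integral_integral_swap (integrable_gaussPDF_prod hσ)]
  simp [integral_gaussPDF n _ hσ]

theorem sq_gaussPDF_mixture_div (y : Fin n → ℝ) :
    (∫ f, gaussPDF n f σ y ∂M) ^ 2 / gaussPDF n g σ y =
      ∫ p : (Fin n → ℝ) × (Fin n → ℝ),
        gaussPDF n p.1 σ y * gaussPDF n p.2 σ y / gaussPDF n g σ y ∂(M.prod M) := by
  rw [integral_div, integral_prod_mul (fun f => gaussPDF n f σ y) (fun f => gaussPDF n f σ y), sq]

theorem integral_gaussPDF_mul_div (f ν : Fin n → ℝ) (hσ : 0 < σ) :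
    ∫ y, gaussPDF n f σ y * gaussPDF n ν σ y / gaussPDF n g σ y =
      Real.exp ((∑ i, (f i - g i) * (ν i - g i)) / σ ^ 2) := by
  simp only [gaussPDF_mul_div n _ _ g hσ]
  rw [integral_const_mul, integral_gaussPDF n _ hσ, mul_one]

theorem integrable_gaussPDF_mul_div_prod (hσ : 0 < σ)
    (hint : Integrable (fun p : (Fin n → ℝ) × (Fin n → ℝ) =>
      Real.exp ((∑ i, (p.1 i - g i) * (p.2 i - g i)) / σ ^ 2)) (M.prod M)) :
    Integrable (fun z : (Fin n → ℝ) × ((Fin n → ℝ) × (Fin n → ℝ)) =>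
      gaussPDF n z.2.1 σ z.1 * gaussPDF n z.2.2 σ z.1 / gaussPDF n g σ z.1)
      ((volume : Measure (Fin n → ℝ)).prod (M.prod M)) := by
  have hcont : Continuous (fun z : (Fin n → ℝ) × ((Fin n → ℝ) × (Fin n → ℝ)) =>
      gaussPDF n z.2.1 σ z.1 * gaussPDF n z.2.2 σ z.1 / gaussPDF n g σ z.1) := by
    simp only [gaussPDF_mul_div n _ _ g hσ]
    simp only [gaussPDF_eq_exp, Pi.add_apply, Pi.sub_apply]
    fun_prop
  rw [integrable_prod_iff' hcont.aestronglyMeasurable]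
  refine ⟨ae_of_all _ fun p => ?_, ?_⟩
  · simp only [gaussPDF_mul_div n _ _ g hσ]
    exact (integrable_gaussPDF n _ σ).const_mul _
  · refine hint.congr (ae_of_all _ fun p => ?_)
    simp only
    rw [← integral_gaussPDF_mul_div p.1 p.2 hσ]
    refine integral_congr_ae (ae_of_all _ fun y => (Real.norm_of_nonneg ?_).symm)
    exact div_nonneg (mul_nonneg (gaussPDF_pos n _ hσ y).le (gaussPDF_pos n _ hσ y).le)
      (gaussPDF_pos n _ hσ y).le

theorem integral_abs_gaussPDF_sub_mixture_le (hσ : 0 < σ)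
    (hint : Integrable (fun p : (Fin n → ℝ) × (Fin n → ℝ) =>
      Real.exp ((∑ i, (p.1 i - g i) * (p.2 i - g i)) / σ ^ 2)) (M.prod M)) :
    ∫ y, |gaussPDF n g σ y - ∫ f, gaussPDF n f σ y ∂M| ≤
      √((∫ p : (Fin n → ℝ) × (Fin n → ℝ),
        Real.exp ((∑ i, (p.1 i - g i) * (p.2 i - g i)) / σ ^ 2) ∂(M.prod M)) - 1) := by
  have hT := integrable_gaussPDF_mul_div_prod hσ hint
  have hchi : ∫ y, (∫ f, gaussPDF n f σ y ∂M) ^ 2 / gaussPDF n g σ y =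
      ∫ p : (Fin n → ℝ) × (Fin n → ℝ),
        Real.exp ((∑ i, (p.1 i - g i) * (p.2 i - g i)) / σ ^ 2) ∂(M.prod M) := by
    simp only [sq_gaussPDF_mixture_div]
    rw [integral_integral_swap hT]
    simp only [integral_gaussPDF_mul_div _ _ hσ]
  rw [← hchi]
  refine integral_abs_sub_le_sqrt_chiSq (gaussPDF_pos n g hσ) (integrable_gaussPDF n g σ)
    (integrable_gaussPDF_prod hσ).integral_prod_left ?_ (integral_gaussPDF n g hσ)
    (integral_gaussPDF_mixture hσ)
  simp only [sq_gaussPDF_mixture_div]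
  exact hT.integral_prod_left

end Mixture

theorem integral_uniform_finset {α : Type*} [MeasurableSpace α] [MeasurableSingletonClass α]
    (Ω : Finset α) (φ : α → ℝ) :
    ∫ x, φ x ∂(((Ω.card : ENNReal))⁻¹ • ∑ a ∈ Ω, Measure.dirac a) =
      ((Ω.card : ℝ))⁻¹ * ∑ a ∈ Ω, φ a := by
  rw [integral_smul_measure, integral_finsetSum_measure fun a _ => integrable_dirac (by simp)]
  simp


/-- the `L¹` distance between the Gaussian density `p_g` and the
mixture density `q(y) = ∫ p_f(y) dM(f)` is bounded by
`√(∫∫ exp(⟨f−g, ν−g⟩/σ²·n) dM dM − 1)`, with the corresponding uniform-mixture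
special case for a finite set `Ω`. -/
theorem l1_mixture_bound (n : ℕ) (hn : 1 ≤ n) (σ : ℝ) (hσ : 0 < σ)
    (g : Fin n → ℝ) (M : Measure (Fin n → ℝ)) [IsProbabilityMeasure M]
    (hint : Integrable (fun p : (Fin n → ℝ) × (Fin n → ℝ) =>
      Real.exp ((∑ i, (p.1 i - g i) * (p.2 i - g i)) / σ ^ 2)) (M.prod M)) :
    (∫ y, |gaussPDF n g σ y - ∫ f, gaussPDF n f σ y ∂M| ≤
      Real.sqrt ((∫ p : (Fin n → ℝ) × (Fin n → ℝ),
        Real.exp ((∑ i, (p.1 i - g i) * (p.2 i - g i)) / σ ^ 2) ∂(M.prod M)) - 1)) ∧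
    (∀ Ω : Finset (Fin n → ℝ), Ω.Nonempty →
      M = ((Ω.card : ENNReal))⁻¹ • ∑ f ∈ Ω, Measure.dirac f →
      ∫ y, |gaussPDF n g σ y - ∫ f, gaussPDF n f σ y ∂M| ≤
        Real.sqrt (((Ω.card : ℝ))⁻¹ ^ 2 *
          (∑ f ∈ Ω, ∑ ν ∈ Ω,
            Real.exp ((∑ i, (f i - g i) * (ν i - g i)) / σ ^ 2)) - 1)) := by
  refine ⟨integral_abs_gaussPDF_sub_mixture_le hσ hint, fun Ω _ hM => ?_⟩
  refine (integral_abs_gaussPDF_sub_mixture_le hσ hint).trans_eq ?_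
  rw [integral_prod _ hint]
  simp only [hM, integral_uniform_finset]
  rw [← Finset.mul_sum, ← mul_assoc, ← sq]

end
end

section
/- Let F be a nonzero linear subspace of ℝⁿ, σ > 0 and ε > 0. Then m_∞(ε, F, F) = τ( ε/(σ·Ω_F) ). -/
open MeasureTheory ProbabilityTheory Real

noncomputable section

/-- `m_∞(ε, A₀, A₁) = inf{ d_TV(P_f, P_g) : f ∈ A₀, g ∈ A₁, ‖f−g‖_∞ ≥ ε }`. -/
def mInf (n : ℕ) (σ : ℝ) (ε : ℝ) (A₀ A₁ : Set (Fin n → ℝ)) : ℝ :=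
  sInf {r : ℝ | ∃ f ∈ A₀, ∃ g ∈ A₁, ε ≤ normInf n (f - g) ∧
    r = dTV n (gaussP n f σ) (gaussP n g σ)}

/-- Euclidean (unnormalized) norm `√(∑ vᵢ²)`. -/
def euclNorm {n : ℕ} (v : Fin n → ℝ) : ℝ := Real.sqrt (∑ i, (v i) ^ 2)

lemma euclNorm_nonneg {n : ℕ} (v : Fin n → ℝ) : 0 ≤ euclNorm v := Real.sqrt_nonneg _

lemma euclNorm_sq {n : ℕ} (v : Fin n → ℝ) : euclNorm v ^ 2 = ∑ i, (v i) ^ 2 :=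
  Real.sq_sqrt (Finset.sum_nonneg fun _ _ => sq_nonneg _)

lemma euclNorm_pos {n : ℕ} {v : Fin n → ℝ} (hv : v ≠ 0) : 0 < euclNorm v := by
  obtain ⟨i, hi⟩ := Function.ne_iff.mp hv
  refine Real.sqrt_pos.mpr (Finset.sum_pos' (fun _ _ => sq_nonneg _) ⟨i, Finset.mem_univ i, ?_⟩)
  exact sq_pos_of_ne_zero hi

lemma abs_sum_mul_le_euclNorm {n : ℕ} (u v : Fin n → ℝ) :
    |∑ i, u i * v i| ≤ euclNorm u * euclNorm v := by
  refine abs_le_of_sq_le_sq ?_ (mul_nonneg (euclNorm_nonneg u) (euclNorm_nonneg v))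
  rw [mul_pow, euclNorm_sq, euclNorm_sq]
  exact Finset.sum_mul_sq_le_sq_mul_sq _ _ _

lemma stdCDF_mono : Monotone stdCDF := fun _ _ h =>
  measureReal_mono (μ := gaussianReal 0 1) (Set.Iic_subset_Iic.mpr h)

lemma tau_mono : Monotone tau := fun _ _ h =>
  sub_le_sub (stdCDF_mono (by linarith)) (stdCDF_mono (by linarith))

lemma gaussianReal_real_Iic (m c : ℝ) {s : ℝ} (hs : 0 < s) :
    (gaussianReal m (Real.toNNReal (s ^ 2))).real (Set.Iic c) = stdCDF ((c - m) / s) := by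
  have hmap : gaussianReal m (Real.toNNReal (s ^ 2)) =
      (gaussianReal 0 1).map (fun x => s * x + m) := by
    have : (fun x => s * x + m) = (fun x => x + m) ∘ (fun x => s * x) := rfl
    rw [this, ← Measure.map_map (by fun_prop) (by fun_prop), gaussianReal_map_const_mul,
      gaussianReal_map_add_const]
    congr 1
    · simp
    · ext; simp [sq_nonneg]
  rw [hmap, map_measureReal_apply (by fun_prop) measurableSet_Iic, stdCDF]
  congr 2
  ext x
  simp only [Set.mem_preimage, Set.mem_Iic, le_div_iff₀ hs]
  constructor <;> intro h <;> linarith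

instance isProbabilityMeasure_gaussP (n : ℕ) (f : Fin n → ℝ) (σ : ℝ) :
    IsProbabilityMeasure (gaussP n f σ) := by
  unfold gaussP; infer_instance

lemma gaussP_eq_withDensity (n : ℕ) (f : Fin n → ℝ) {σ : ℝ} (hσ : 0 < σ) :
    gaussP n f σ = volume.withDensity fun y : Fin n → ℝ =>
      ENNReal.ofReal (∏ i, gaussianPDFReal (f i) (Real.toNNReal (σ ^ 2)) (y i)) := by
  have hv : Real.toNNReal (σ ^ 2) ≠ 0 := by
    rw [ne_eq, Real.toNNReal_eq_zero, not_le]; positivity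
  refine Measure.pi_eq fun s hs => ?_
  have hind : ∀ y : Fin n → ℝ, (Set.univ.pi s).indicator (fun y : Fin n → ℝ =>
      ∏ i, gaussianPDFReal (f i) (Real.toNNReal (σ ^ 2)) (y i)) y =
      ∏ i, (s i).indicator (gaussianPDFReal (f i) (Real.toNNReal (σ ^ 2))) (y i) := by
    intro y
    by_cases hy : y ∈ Set.univ.pi s
    · rw [Set.indicator_of_mem hy]
      exact Finset.prod_congr rfl fun i _ => (Set.indicator_of_mem (hy i trivial) _).symm
    · rw [Set.indicator_of_notMem hy]
      simp only [Set.mem_pi, Set.mem_univ, true_imp_iff, not_forall] at hy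
      obtain ⟨i, hi⟩ := hy
      exact (Finset.prod_eq_zero (Finset.mem_univ i) (Set.indicator_of_notMem hi _)).symm
  have hbox : MeasurableSet (Set.univ.pi s) := MeasurableSet.univ_pi hs
  have hint : Integrable (fun y : Fin n → ℝ =>
      ∏ i, gaussianPDFReal (f i) (Real.toNNReal (σ ^ 2)) (y i)) :=
    Integrable.fintype_prod_dep fun i => integrable_gaussianPDFReal _ _
  rw [withDensity_apply _ hbox, ← ofReal_integral_eq_lintegral_ofReal hint.integrableOn
    (Filter.Eventually.of_forall fun y =>
      Finset.prod_nonneg fun i _ => gaussianPDFReal_nonneg _ _ _), ← integral_indicator hbox]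
  simp_rw [hind]
  rw [integral_fintype_prod_volume_eq_prod
    (f := fun i => (s i).indicator (gaussianPDFReal (f i) (Real.toNNReal (σ ^ 2)))),
    ENNReal.ofReal_prod_of_nonneg]
  · refine Finset.prod_congr rfl fun i _ => ?_
    rw [integral_indicator (hs i), gaussianReal_apply_eq_integral _ hv]
  · exact fun i _ => integral_nonneg fun x =>
      Set.indicator_nonneg (fun _ _ => gaussianPDFReal_nonneg _ _ _) _

/-- On a set of points closer to `g` than to `f`, the Gaussian measure centred at `g` dominates. -/
lemma gaussP_real_le_of_closer {n : ℕ} {f g : Fin n → ℝ} {σ : ℝ} (hσ : 0 < σ)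
    {s : Set (Fin n → ℝ)} (hs : MeasurableSet s)
    (h : ∀ y ∈ s, ∑ i, (y i - g i) ^ 2 ≤ ∑ i, (y i - f i) ^ 2) :
    (gaussP n f σ).real s ≤ (gaussP n g σ).real s := by
  refine ENNReal.toReal_mono (measure_ne_top _ _) ?_
  rw [gaussP_eq_withDensity n f hσ, gaussP_eq_withDensity n g hσ, withDensity_apply _ hs,
    withDensity_apply _ hs]
  refine setLIntegral_mono_ae' hs (Filter.Eventually.of_forall fun y hy => ?_)
  refine ENNReal.ofReal_le_ofReal ?_
  simp only [gaussianPDFReal, Finset.prod_mul_distrib, ← Real.exp_sum]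
  gcongr ?_ * Real.exp ?_
  simp only [← Finset.sum_div, Finset.sum_neg_distrib]
  have := h y hy
  gcongr

lemma gaussP_map_linear {n : ℕ} (f h : Fin n → ℝ) (σ : ℝ) :
    (gaussP n f σ).map (fun y => ∑ i, h i * y i) =
      gaussianReal (∑ i, h i * f i) (Real.toNNReal ((σ * euclNorm h) ^ 2)) := by
  have hLp : ∀ i, MemLp (fun x : ℝ => h i * x) 2
      (gaussianReal (f i) (Real.toNNReal (σ ^ 2))) :=
    fun i => (memLp_id_gaussianReal 2).const_mul (h i)
  have hlaw : HasGaussianLaw (fun y : Fin n → ℝ => ∑ i, h i * y i) (gaussP n f σ) := by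
    refine iIndepFun.hasGaussianLaw_fun_sum (X := fun i (y : Fin n → ℝ) => h i * y i)
      (fun i => ?_) (iIndepFun_pi (X := fun i x => h i * x) fun i => by fun_prop)
    constructor
    have hcomp : (fun y : Fin n → ℝ => h i * y i) = (fun x => h i * x) ∘ Function.eval i := rfl
    rw [hcomp, ← Measure.map_map (by fun_prop) (by fun_prop), gaussP,
      (measurePreserving_eval _ i).map_eq, gaussianReal_map_const_mul]
    infer_instance
  rw [hlaw.map_eq_gaussianReal]
  congr 1
  · rw [gaussP, integral_finsetSum]
    · refine Finset.sum_congr rfl fun i _ => ?_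
      rw [integral_const_mul,
        integral_comp_eval (μ := fun i => gaussianReal (f i) (Real.toNNReal (σ ^ 2)))
          (f := fun x : ℝ => x) (by fun_prop), integral_id_gaussianReal]
    · exact fun i _ => integrable_comp_eval
        (μ := fun i => gaussianReal (f i) (Real.toNNReal (σ ^ 2))) (f := fun x : ℝ => h i * x)
        ((hLp i).integrable one_le_two)
  · have hsum : (fun y : Fin n → ℝ => ∑ i, h i * y i) = ∑ i, fun y => h i * y i := by
      ext y; simp
    rw [hsum, gaussP, variance_sum_pi (X := fun i x => h i * x) hLp]
    congr 1
    rw [mul_pow, euclNorm_sq, Finset.mul_sum]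
    refine Finset.sum_congr rfl fun i _ => ?_
    rw [variance_const_mul, variance_fun_id_gaussianReal, Real.coe_toNNReal _ (sq_nonneg σ)]
    ring

lemma gaussP_real_halfspace {n : ℕ} (f : Fin n → ℝ) {h : Fin n → ℝ} (hh : h ≠ 0) (c : ℝ)
    {σ : ℝ} (hσ : 0 < σ) :
    (gaussP n f σ).real {y | ∑ i, h i * y i ≤ c} =
      stdCDF ((c - ∑ i, h i * f i) / (σ * euclNorm h)) := by
  rw [← gaussianReal_real_Iic _ _ (mul_pos hσ (euclNorm_pos hh)), ← gaussP_map_linear,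
    map_measureReal_apply (by fun_prop) measurableSet_Iic]
  rfl

/-- If `P ≤ Q` on `H` and `Q ≤ P` off `H`, then the total variation distance is
`Q H - P H`. -/
lemma dTV_eq_of_dominates {n : ℕ} {P Q : Measure (Fin n → ℝ)} [IsProbabilityMeasure P]
    [IsProbabilityMeasure Q] {H : Set (Fin n → ℝ)} (hH : MeasurableSet H)
    (hle : ∀ s ⊆ H, MeasurableSet s → P.real s ≤ Q.real s)
    (hge : ∀ s ⊆ Hᶜ, MeasurableSet s → Q.real s ≤ P.real s) :
    dTV n P Q = Q.real H - P.real H := by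
  have hone : ∀ A, MeasurableSet A → Q.real A - P.real A ≤ Q.real H - P.real H := by
    intro A hA
    have h1 := measureReal_inter_add_sdiff (μ := P) (s := A) hH
    have h2 := measureReal_inter_add_sdiff (μ := Q) (s := A) hH
    have h3 := measureReal_inter_add_sdiff (μ := P) (s := H) hA
    have h4 := measureReal_inter_add_sdiff (μ := Q) (s := H) hA
    rw [Set.inter_comm] at h3 h4
    have h5 := hge (A \ H) (fun x hx => hx.2) (hA.diff hH)
    have h6 := hle (H \ A) Set.sdiff_subset (hH.diff hA)
    linarith
  have habs : ∀ A : {A : Set (Fin n → ℝ) // MeasurableSet A},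
      |(P A).toReal - (Q A).toReal| ≤ Q.real H - P.real H := by
    rintro ⟨A, hA⟩
    change |P.real A - Q.real A| ≤ _
    have h1 := hone A hA
    have h2 := hone Aᶜ hA.compl
    rw [probReal_compl_eq_one_sub hA, probReal_compl_eq_one_sub hA] at h2
    exact abs_le.mpr ⟨by linarith, by linarith⟩
  have : Nonempty {A : Set (Fin n → ℝ) // MeasurableSet A} := ⟨⟨H, hH⟩⟩
  refine le_antisymm (ciSup_le habs) ?_
  refine le_trans ?_ (le_ciSup ⟨_, Set.forall_mem_range.mpr habs⟩ ⟨H, hH⟩)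
  change _ ≤ |P.real H - Q.real H|
  rw [abs_sub_comm]
  exact le_abs_self _

/-- The total variation distance between two Gaussian shifts. -/
lemma dTV_gaussP {n : ℕ} {f g : Fin n → ℝ} (hfg : f ≠ g) {σ : ℝ} (hσ : 0 < σ) :
    dTV n (gaussP n f σ) (gaussP n g σ) = tau (euclNorm (f - g) / σ) := by
  have hh : f - g ≠ 0 := sub_ne_zero.mpr hfg
  have hpos := euclNorm_pos hh
  set H : Set (Fin n → ℝ) := {y | ∑ i, (y i - g i) ^ 2 ≤ ∑ i, (y i - f i) ^ 2} with hHdef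
  have hH : MeasurableSet H := measurableSet_le (by fun_prop) (by fun_prop)
  have hhalf : H = {y | ∑ i, (f - g) i * y i ≤ ∑ i, (f - g) i * ((f i + g i) / 2)} := by
    ext y
    have key : ∑ i, (y i - f i) ^ 2 - ∑ i, (y i - g i) ^ 2 =
        2 * (∑ i, (f - g) i * ((f i + g i) / 2) - ∑ i, (f - g) i * y i) := by
      rw [← Finset.sum_sub_distrib, ← Finset.sum_sub_distrib, Finset.mul_sum]
      refine Finset.sum_congr rfl fun i _ => ?_
      simp only [Pi.sub_apply]
      ring
    simp only [hHdef, Set.mem_ofPred_eq]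
    constructor <;> intro h <;> linarith
  rw [dTV_eq_of_dominates hH
    (fun s hs hms => gaussP_real_le_of_closer hσ hms fun y hy => hs hy)
    (fun s hs hms => gaussP_real_le_of_closer hσ hms fun y hy =>
      le_of_not_ge fun hle => hs hy hle),
    hhalf, gaussP_real_halfspace g hh _ hσ, gaussP_real_halfspace f hh _ hσ, tau]
  have hg : ∑ i, (f - g) i * ((f i + g i) / 2) - ∑ i, (f - g) i * g i =
      euclNorm (f - g) ^ 2 / 2 := by
    rw [euclNorm_sq, ← Finset.sum_sub_distrib, Finset.sum_div]
    refine Finset.sum_congr rfl fun i _ => ?_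
    simp only [Pi.sub_apply]
    ring
  have hf : ∑ i, (f - g) i * ((f i + g i) / 2) - ∑ i, (f - g) i * f i =
      -(euclNorm (f - g) ^ 2 / 2) := by
    rw [euclNorm_sq, ← Finset.sum_sub_distrib, Finset.sum_div, ← Finset.sum_neg_distrib]
    refine Finset.sum_congr rfl fun i _ => ?_
    simp only [Pi.sub_apply]
    ring
  rw [hg, hf]
  congr 2 <;> field_simp

lemma IsOrthProjOn.sum_single_mul {n : ℕ} (hn : 1 ≤ n) {F : Submodule ℝ (Fin n → ℝ)}
    {P : (Fin n → ℝ) →ₗ[ℝ] (Fin n → ℝ)} (hP : IsOrthProjOn n F P) (i : Fin n)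
    {u : Fin n → ℝ} (hu : u ∈ F) : ∑ j, P (Pi.single i 1) j * u j = u i := by
  have h := hP.2 (Pi.single i 1) u hu
  have hn' : (n : ℝ) ≠ 0 := by exact_mod_cast Nat.one_le_iff_ne_zero.mp hn
  rw [inner2, div_eq_zero_iff, or_iff_left hn'] at h
  simp only [Pi.sub_apply, sub_mul, Finset.sum_sub_distrib] at h
  have hs : ∑ j, (Pi.single i 1 : Fin n → ℝ) j * u j = u i := by
    simp [Pi.single_apply]
  linarith

lemma OmegaF_eq_iSup_euclNorm {n : ℕ} (hn : 1 ≤ n) (P : (Fin n → ℝ) →ₗ[ℝ] (Fin n → ℝ)) :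
    OmegaF n P = ⨆ i, euclNorm (P (Pi.single i 1)) := by
  have hn' : (0 : ℝ) < n := by exact_mod_cast hn
  refine iSup_congr fun i => ?_
  have hs : ∑ j, (Pi.single i 1 : Fin n → ℝ) j ^ 2 = 1 := by
    simp [Pi.single_apply]
  rw [norm2, norm2, hs, ← Real.sqrt_div' _ (by positivity), euclNorm]
  congr 1
  field_simp

/-- for a nonzero subspace `F`, `m_∞(ε, F, F) = τ(ε/(σ·Ω_F))`. -/
theorem mInf_subspace (n : ℕ) (hn : 1 ≤ n) (σ : ℝ) (hσ : 0 < σ)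
    (F : Submodule ℝ (Fin n → ℝ)) (hF : F ≠ ⊥)
    (P : (Fin n → ℝ) →ₗ[ℝ] (Fin n → ℝ)) (hP : IsOrthProjOn n F P)
    (ε : ℝ) (hε : 0 < ε) :
    mInf n σ ε (F : Set (Fin n → ℝ)) (F : Set (Fin n → ℝ)) =
      tau (ε / (σ * OmegaF n P)) := by
  have hn0 : Nonempty (Fin n) := ⟨⟨0, hn⟩⟩
  have hrep := fun i {u} (hu : u ∈ F) => hP.sum_single_mul hn i hu
  have hΩ := OmegaF_eq_iSup_euclNorm hn P
  obtain ⟨k, hk⟩ := exists_eq_ciSup_of_finite (f := fun i => euclNorm (P (Pi.single i 1)))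
  have hle : ∀ i, euclNorm (P (Pi.single i 1)) ≤ OmegaF n P := fun i => by
    rw [hΩ]
    exact le_ciSup (f := fun i => euclNorm (P (Pi.single i 1))) (Set.finite_range _).bddAbove i
  rw [← hΩ] at hk
  have hcoord : ∀ u ∈ F, ∀ i, |u i| ≤ OmegaF n P * euclNorm u := fun u hu i => by
    rw [← hrep i hu]
    exact (abs_sum_mul_le_euclNorm _ _).trans
      (mul_le_mul_of_nonneg_right (hle i) (euclNorm_nonneg u))
  have hΩpos : 0 < OmegaF n P := by
    obtain ⟨u, hu, hu0⟩ := Submodule.exists_mem_ne_zero_of_ne_bot hF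
    obtain ⟨i, hi⟩ := Function.ne_iff.mp hu0
    exact pos_of_mul_pos_left ((abs_pos.mpr hi).trans_le (hcoord u hu i)) (euclNorm_nonneg u)
  refine IsLeast.csInf_eq ⟨?_, ?_⟩
  · set w := P (Pi.single k 1) with hw
    have hwF : w ∈ F := hP.1 _
    have hwk : w k = OmegaF n P ^ 2 := by
      rw [← hk, euclNorm_sq, ← hrep k hwF]
      exact Finset.sum_congr rfl fun j _ => (sq _).symm
    set c := ε / OmegaF n P ^ 2 with hc
    have hcpos : 0 < c := by positivity
    have hck : (c • w) k = ε := by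
      rw [Pi.smul_apply, smul_eq_mul, hwk, hc]
      field_simp
    have hne : c • w ≠ 0 := fun h => hε.ne (by rw [← hck, h]; rfl)
    refine ⟨c • w, F.smul_mem c hwF, 0, F.zero_mem, ?_, ?_⟩
    · rw [sub_zero, normInf]
      refine le_trans (le_of_eq ?_)
        (le_ciSup (f := fun i => |(c • w) i|) (Set.finite_range _).bddAbove k)
      simp only [hck, abs_of_pos hε]
    · have hnorm : euclNorm (c • w) = ε / OmegaF n P := by
        rw [← sq_eq_sq₀ (euclNorm_nonneg _) (by positivity), euclNorm_sq]
        simp only [Pi.smul_apply, smul_eq_mul, mul_pow]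
        rw [← Finset.mul_sum, ← euclNorm_sq, hk, hc]
        field_simp
      rw [dTV_gaussP hne hσ, sub_zero, hnorm]
      congr 1
      field_simp
  · rintro r ⟨f, hf, g, hg, hfg, rfl⟩
    have hle' : ε ≤ OmegaF n P * euclNorm (f - g) :=
      hfg.trans (ciSup_le (hcoord _ (F.sub_mem hf hg)))
    have hne : f ≠ g := by
      rintro rfl
      simp [euclNorm] at hle'
      linarith
    rw [dTV_gaussP hne hσ]
    refine tau_mono ?_
    rw [div_le_div_iff₀ (by positivity) hσ]
    nlinarith

end
end
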